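/- arXiv:1412.8621 — 2 statements merged into one kernel-verified Lean document; each statement's English description precedes it below -/
import Mathlib

section
/- (n-dimensional Hex theorem) Suppose the cube [0,1]^n is covered by n closed sets X_1, …, X_n. Then there exists an index i ∈ {1,…,n} and a connected component Y of X_i such that Y intersects both opposite facets {x ∈ [0,1]^n : x_i = 0} and {x ∈ [0,1]^n : x_i = 1}. -/
open Set

/-- The unit cube `[0,1]^n` in `ℝ^n`. -/
def Cube (n : ℕ) : Set (EuclideanSpace ℝ (Fin n)) :=
  {x | ∀ j, x j ∈ Set.Icc (0 : ℝ) 1}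

section Combinatorics

/-- vertices of the path -/
def pathV {n : ℕ} (x : Fin n → ℕ) (σ : Equiv.Perm (Fin n)) (i : ℕ) : Fin n → ℕ :=
  fun j => x j + if (σ.symm j : ℕ) < i then 1 else 0

theorem sum_insertNth {M : Type*} [AddCommMonoid M] {n k : ℕ} (p : Fin (n+1)) (f : (Fin (n+1) → ℕ) → M) :
    ∑ x : Fin (n+1) → Fin k, f (fun i => (x i : ℕ)) =
      ∑ y : Fin n → Fin k, ∑ t : Fin k, f (p.insertNth (t : ℕ) (fun i => (y i : ℕ))) := by
  rw [← Equiv.sum_comp (Fin.insertNthEquiv (fun _ => Fin k) p), Fintype.sum_prod_type, Finset.sum_comm]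
  refine Finset.sum_congr rfl fun y _ => Finset.sum_congr rfl fun t _ => ?_
  congr 1
  funext i
  refine Fin.succAboveCases p ?_ (fun j => ?_) i <;> simp

theorem sum_telescope {M : Type*} [AddCommGroup M] {n k : ℕ} (p : Fin (n+1)) (H : (Fin (n+1) → ℕ) → M) :
    ∑ x : Fin (n+1) → Fin k,
      (H (fun i => (x i : ℕ) + if i = p then 1 else 0) - H (fun i => (x i : ℕ))) =
      ∑ y : Fin n → Fin k,
        (H (p.insertNth k (fun i => (y i : ℕ))) - H (p.insertNth 0 (fun i => (y i : ℕ)))) := by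
  rw [sum_insertNth p (fun x => H (fun i => x i + if i = p then 1 else 0) - H x)]
  refine Finset.sum_congr rfl fun y _ => ?_
  have := Finset.sum_range_sub (fun t => H (p.insertNth t (fun i => (y i : ℕ)))) k
  rw [← this, ← Fin.sum_univ_eq_sum_range (fun t => H (p.insertNth (t+1) (fun i => (y i : ℕ))) - H (p.insertNth t (fun i => (y i : ℕ))))]
  refine Finset.sum_congr rfl fun t _ => ?_
  congr 2
  funext i
  refine Fin.succAboveCases p ?_ (fun j => ?_) i <;> simp

theorem pathV_swap {n : ℕ} (x : Fin n → ℕ) (σ : Equiv.Perm (Fin n)) (a b : Fin n)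
    (h : (b : ℕ) = a + 1) (i : ℕ) (hi : i ≠ a + 1) :
    pathV x (σ * Equiv.swap a b) i = pathV x σ i := by
  funext c
  have : (σ * Equiv.swap a b).symm c = Equiv.swap a b (σ.symm c) := by
    rw [Equiv.symm_apply_eq, Equiv.Perm.mul_apply, Equiv.swap_apply_self, Equiv.apply_symm_apply]
  unfold pathV
  rw [this, Equiv.swap_apply_def]
  congr 1
  split_ifs with h1 h2 h3 h4 <;> simp_all <;> omega

theorem pathV_rotate {n : ℕ} (x : Fin (n+1) → ℕ) (σ : Equiv.Perm (Fin (n+1))) (i : ℕ) (hi : i ≤ n) :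
    pathV x σ (i+1) = pathV (fun c => x c + if c = σ 0 then 1 else 0) (σ * finRotate (n+1)) i := by
  funext c
  obtain ⟨d, rfl⟩ := σ.surjective c
  have e : (σ * finRotate (n+1)).symm (σ d) = (finRotate (n+1)).symm d := by
    rw [Equiv.symm_apply_eq]; simp
  unfold pathV
  simp only [e, Equiv.symm_apply_apply, EmbeddingLike.apply_eq_iff_eq]
  refine Fin.cases ?_ (fun d => ?_) d
  · have : (finRotate (n+1)).symm 0 = Fin.last n := by
      rw [Equiv.symm_apply_eq]; simp
    rw [this]
    simp; omega
  · have : (finRotate (n+1)).symm d.succ = d.castSucc := by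
      rw [Equiv.symm_apply_eq]; simp
    rw [this]
    simp

/-- coordinate `σ 0` is not moved by the first `n` steps of the rotated path -/
theorem pathV_rotate_fixed {n : ℕ} (x : Fin (n+1) → ℕ) (σ : Equiv.Perm (Fin (n+1))) (i : ℕ) (hi : i ≤ n) :
    pathV x (σ * finRotate (n+1)) i (σ 0) = x (σ 0) := by
  have e : (σ * finRotate (n+1)).symm (σ 0) = Fin.last n := by
    rw [Equiv.symm_apply_eq]; simp
  unfold pathV
  rw [e]; simp; omega

theorem pathV_cons {n : ℕ} (y : Fin n → ℕ) (t : ℕ) (e : Equiv.Perm (Fin n)) (i : ℕ) (hi : i ≤ n) :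
    pathV (Fin.cons t y : Fin (n+1) → ℕ) (Equiv.Perm.decomposeFin.symm (0, e) * finRotate (n+1)) i
      = Fin.cons t (pathV y e i) := by
  funext c
  refine Fin.cases ?_ (fun d => ?_) c
  · have := pathV_rotate_fixed (Fin.cons t y) (Equiv.Perm.decomposeFin.symm (0, e)) i hi
    simpa using this
  · have : (Equiv.Perm.decomposeFin.symm (0, e) * finRotate (n+1)).symm d.succ = (e.symm d).castSucc := by
      rw [Equiv.symm_apply_eq]; simp
    unfold pathV
    rw [this]; simp

/-- a sum over permutations of something that does not use vertex `a+1` vanishes mod 2 -/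
theorem sum_perm_swap_zero {n : ℕ} (a b : Fin n) (h : (b : ℕ) = a + 1)
    (f : Equiv.Perm (Fin n) → ZMod 2) (hf : ∀ σ, f (σ * Equiv.swap a b) = f σ) :
    ∑ σ, f σ = 0 := by
  have hab : a ≠ b := by rintro rfl; omega
  refine Finset.sum_involution (fun σ _ => σ * Equiv.swap a b) ?_ ?_ ?_ ?_
  · intro σ _
    rw [hf]; exact CharTwo.add_self_eq_zero _
  · intro σ _ _ h1
    have := mul_eq_left.1 h1
    exact hab (Equiv.swap_eq_one_iff.1 this)
  · simp
  · intro σ _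
    simp [mul_assoc]

/-- mixed products -/
def mixR {n : ℕ} (b : Fin (n+1) → (Fin (n+1) → ℕ) → ZMod 2) (x : Fin (n+1) → ℕ)
    (σ : Equiv.Perm (Fin (n+1))) (j : ℕ) : ZMod 2 :=
  ∏ i : Fin n, if (i : ℕ) < j then b i.succ (pathV x σ (i+1)) - b i.succ (pathV x σ i)
    else b i.succ (pathV x σ (i+2)) - b i.succ (pathV x σ (i+1))

theorem sum_mixR_step {n : ℕ} (b : Fin (n+1) → (Fin (n+1) → ℕ) → ZMod 2) (x : Fin (n+1) → ℕ)
    (j : ℕ) (hj : j < n) :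
    ∑ σ, b 0 (pathV x σ 0) * mixR b x σ j = ∑ σ, b 0 (pathV x σ 0) * mixR b x σ (j+1) := by
  rw [← sub_eq_zero, ← Finset.sum_sub_distrib]
  have key : ∀ σ, b 0 (pathV x σ 0) * mixR b x σ j - b 0 (pathV x σ 0) * mixR b x σ (j+1)
      = b 0 (pathV x σ 0) * ((b (Fin.succ ⟨j, hj⟩) (pathV x σ (j+2)) - b (Fin.succ ⟨j, hj⟩) (pathV x σ j)) *
        ∏ i ∈ Finset.univ.erase (⟨j, hj⟩ : Fin n),
          if (i : ℕ) < j then b i.succ (pathV x σ (i+1)) - b i.succ (pathV x σ i)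
          else b i.succ (pathV x σ (i+2)) - b i.succ (pathV x σ (i+1))) := by
    intro σ
    unfold mixR
    rw [← Finset.mul_prod_erase Finset.univ _ (Finset.mem_univ (⟨j, hj⟩ : Fin n)),
      ← Finset.mul_prod_erase Finset.univ (fun i : Fin n => if (i : ℕ) < j + 1 then _ else _) (Finset.mem_univ (⟨j, hj⟩ : Fin n))]
    have : ∏ i ∈ Finset.univ.erase (⟨j, hj⟩ : Fin n),
          (if (i : ℕ) < j + 1 then b i.succ (pathV x σ (i+1)) - b i.succ (pathV x σ i)
          else b i.succ (pathV x σ (i+2)) - b i.succ (pathV x σ (i+1)))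
        = ∏ i ∈ Finset.univ.erase (⟨j, hj⟩ : Fin n),
          if (i : ℕ) < j then b i.succ (pathV x σ (i+1)) - b i.succ (pathV x σ i)
          else b i.succ (pathV x σ (i+2)) - b i.succ (pathV x σ (i+1)) := by
      refine Finset.prod_congr rfl fun i hi => ?_
      have : (i : ℕ) ≠ j := by
        intro h; exact (Finset.mem_erase.1 hi).1 (Fin.ext h)
      have : (i : ℕ) < j + 1 ↔ (i : ℕ) < j := by omega
      simp only [this]
    rw [this]
    simp only [lt_irrefl, if_false, Nat.lt_succ_self, if_true]
    simp only [CharTwo.sub_eq_add]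
    generalize (∏ i ∈ Finset.univ.erase (⟨j, hj⟩ : Fin n), _ : ZMod 2) = P
    generalize b (Fin.succ ⟨j, hj⟩) (pathV x σ (j+1)) = Y
    have hY : Y + Y = 0 := CharTwo.add_self_eq_zero _
    linear_combination (b 0 (pathV x σ 0) * P) * hY
  simp only [key]
  refine sum_perm_swap_zero (⟨j, by omega⟩ : Fin (n+1)) ⟨j+1, by omega⟩ rfl _ fun σ => ?_
  have hv : ∀ i, i ≠ j + 1 → pathV x (σ * Equiv.swap (⟨j, by omega⟩ : Fin (n+1)) ⟨j+1, by omega⟩) i = pathV x σ i :=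
    fun i hi => pathV_swap x σ _ _ rfl i hi
  rw [hv 0 (by omega), hv (j+2) (by omega), hv j (by omega)]
  congr 2
  refine Finset.prod_congr rfl fun i hi => ?_
  have h1 : (i : ℕ) ≠ j := by
    intro h; exact (Finset.mem_erase.1 hi).1 (Fin.ext h)
  split_ifs with h
  · rw [hv (i+1) (by omega), hv i (by omega)]
  · rw [hv (i+1) (by omega), hv (i+2) (by omega)]

theorem sum_mixR {n : ℕ} (b : Fin (n+1) → (Fin (n+1) → ℕ) → ZMod 2) (x : Fin (n+1) → ℕ)
    (j : ℕ) (hj : j ≤ n) :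
    ∑ σ, b 0 (pathV x σ 0) * mixR b x σ 0 = ∑ σ, b 0 (pathV x σ 0) * mixR b x σ j := by
  induction j with
  | zero => rfl
  | succ j ih => rw [ih (by omega), sum_mixR_step b x j (by omega)]

def lastH {n : ℕ} (b : Fin (n+1) → (Fin (n+1) → ℕ) → ZMod 2) (σ : Equiv.Perm (Fin (n+1)))
    (x : Fin (n+1) → ℕ) : ZMod 2 :=
  b 0 (pathV x σ 0) * ∏ i : Fin n, (b i.succ (pathV x σ (i+1)) - b i.succ (pathV x σ i))

theorem sum_eq_one (k : ℕ) : ∀ (n : ℕ) (b : Fin n → (Fin n → ℕ) → ZMod 2)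
    (_ : ∀ i x, x i = 0 → b i x = 0) (_ : ∀ i x, x i = k → b i x = 1),
    ∑ x : Fin n → Fin k, ∑ σ : Equiv.Perm (Fin n),
      ∏ i : Fin n, (b i (pathV (fun c => (x c : ℕ)) σ (i+1)) - b i (pathV (fun c => (x c : ℕ)) σ i)) = 1 := by
  intro n
  induction n with
  | zero => intro b _ _; simp
  | succ n ih =>
    intro b h0 h1
    have step1 : ∀ x : Fin (n+1) → ℕ, ∑ σ : Equiv.Perm (Fin (n+1)),
        ∏ i : Fin (n+1), (b i (pathV x σ (i+1)) - b i (pathV x σ i)) =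
        ∑ σ : Equiv.Perm (Fin (n+1)), (lastH b (σ * finRotate (n+1)) (fun c => x c + if c = σ 0 then 1 else 0)
          - lastH b (σ * finRotate (n+1)) x) := by
      intro x
      have e1 : ∀ σ : Equiv.Perm (Fin (n+1)), ∏ i : Fin (n+1), (b i (pathV x σ (i+1)) - b i (pathV x σ i))
          = lastH b (σ * finRotate (n+1)) (fun c => x c + if c = σ 0 then 1 else 0)
            - b 0 (pathV x σ 0) * mixR b x σ 0 := by
        intro σ
        have e2 : lastH b (σ * finRotate (n+1)) (fun c => x c + if c = σ 0 then 1 else 0)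
            = b 0 (pathV x σ 1) * mixR b x σ 0 := by
          unfold lastH mixR
          rw [← pathV_rotate x σ 0 (by omega)]
          congr 1
          refine Finset.prod_congr rfl fun i _ => ?_
          rw [← pathV_rotate x σ i (by omega), ← pathV_rotate x σ (i+1) (by omega)]
          simp
        rw [e2, Fin.prod_univ_succ, ← sub_mul]
        simp [mixR]
      simp only [e1, Finset.sum_sub_distrib]
      congr 1
      rw [sum_mixR b x n le_rfl]
      rw [← Equiv.sum_comp (Equiv.mulRight (finRotate (n+1)))]
      refine Finset.sum_congr rfl fun σ _ => ?_
      simp [lastH, mixR]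
    rw [Finset.sum_congr rfl fun x _ => step1 _, Finset.sum_comm]
    have step2 : ∀ σ : Equiv.Perm (Fin (n+1)), ∀ x : Fin (n+1) → ℕ, σ 0 ≠ 0 → (x (σ 0) = 0 ∨ x (σ 0) = k) →
        lastH b (σ * finRotate (n+1)) x = 0 := by
      intro σ x hσ hx
      obtain ⟨i, hi⟩ := Fin.exists_succ_eq.2 hσ
      unfold lastH
      rw [Finset.prod_eq_zero (Finset.mem_univ i), mul_zero]
      have f1 := pathV_rotate_fixed x σ i (by omega)
      have f2 := pathV_rotate_fixed x σ (i+1) (by omega)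
      rcases hx with hx | hx
      · rw [h0 _ _ (by rw [hi, f2, hx]), h0 _ _ (by rw [hi, f1, hx])]; simp
      · rw [h1 _ _ (by rw [hi, f2, hx]), h1 _ _ (by rw [hi, f1, hx])]; simp
    rw [Finset.sum_congr rfl fun σ _ => sum_telescope (σ 0) (lastH b (σ * finRotate (n+1)))]
    rw [← Equiv.sum_comp Equiv.Perm.decomposeFin.symm, Fintype.sum_prod_type,
      Finset.sum_eq_single 0 ?_ (by simp)]
    · rw [Finset.sum_comm]
      rw [← ih (fun i y => b i.succ (Fin.cons k y)) (fun i x hx => h0 _ _ (by simpa using hx))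
        (fun i x hx => h1 _ _ (by simpa using hx))]
      refine Finset.sum_congr rfl fun y _ => Finset.sum_congr rfl fun e _ => ?_
      simp only [Equiv.Perm.decomposeFin_symm_apply_zero, Fin.insertNth_zero']
      unfold lastH
      rw [pathV_cons _ _ _ _ (by omega), pathV_cons _ _ _ _ (by omega)]
      rw [h1 0 _ (by simp), h0 0 _ (by simp)]
      rw [zero_mul, sub_zero, one_mul]
      refine Finset.prod_congr rfl fun i _ => ?_
      rw [pathV_cons _ _ _ _ (by omega), pathV_cons _ _ _ _ (by omega)]
    · intro p _ hp
      refine Finset.sum_eq_zero fun e _ => Finset.sum_eq_zero fun y _ => ?_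
      rw [step2 _ _ (by simpa using hp) (Or.inr (by simp)), step2 _ _ (by simpa using hp) (Or.inl (by simp)), sub_zero]

theorem discrete_pm (k n : ℕ) (b : Fin n → (Fin n → ℕ) → ZMod 2)
    (h0 : ∀ i x, x i = 0 → b i x = 0) (h1 : ∀ i x, x i = k → b i x = 1) :
    ∃ x : Fin n → Fin k, ∀ i, ∃ u w : Fin n → ℕ, b i u ≠ b i w ∧
      (∀ c, (x c : ℕ) ≤ u c ∧ u c ≤ x c + 1) ∧ (∀ c, (x c : ℕ) ≤ w c ∧ w c ≤ x c + 1) := by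
  have h := sum_eq_one k n b h0 h1
  obtain ⟨x, -, hx⟩ := Finset.exists_ne_zero_of_sum_ne_zero (h.symm ▸ one_ne_zero)
  obtain ⟨σ, -, hσ⟩ := Finset.exists_ne_zero_of_sum_ne_zero hx
  refine ⟨x, fun i => ⟨_, _, sub_ne_zero.1 (Finset.prod_ne_zero_iff.1 hσ i (Finset.mem_univ i)), ?_, ?_⟩⟩ <;>
  · intro c
    simp only [pathV]
    split_ifs <;> omega

end Combinatorics

theorem poincare_miranda {n : ℕ} (F : Fin n → (Fin n → ℝ) → ℝ) (hF : ∀ i, Continuous (F i))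
    (h0 : ∀ i x, x i = 0 → F i x ≤ 0) (h1 : ∀ i x, x i = 1 → 0 < F i x) :
    ∃ x ∈ Set.Icc (0 : Fin n → ℝ) 1, ∀ i, F i x = 0 := by
  classical
  by_contra! hcon
  have hK : IsCompact (Set.Icc (0 : Fin n → ℝ) 1) := isCompact_Icc
  have hGc : Continuous (fun x => ∑ i, |F i x|) :=
    continuous_finsetSum _ fun i _ => (hF i).abs
  obtain ⟨z, hz, hmin⟩ := hK.exists_isMinOn ⟨0, by simp⟩ hGc.continuousOn
  have hpos : 0 < ∑ i, |F i z| := by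
    obtain ⟨i, hi⟩ := hcon z hz
    exact Finset.sum_pos' (fun i _ => abs_nonneg _) ⟨i, Finset.mem_univ _, abs_pos.2 hi⟩
  set ε := ∑ i, |F i z| with hε
  set η := ε / (n + 1) with hη
  have hηpos : 0 < η := by positivity
  have huc : ∀ i, ∃ δ > 0, ∀ x ∈ Set.Icc (0 : Fin n → ℝ) 1, ∀ y ∈ Set.Icc (0 : Fin n → ℝ) 1,
      dist x y < δ → dist (F i x) (F i y) < η := by
    intro i
    have := hK.uniformContinuousOn_of_continuous (hF i).continuousOn
    exact Metric.uniformContinuousOn_iff.1 this η hηpos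
  choose δ hδ hδF using huc
  obtain ⟨N, hN⟩ : ∃ N : ℕ, ∀ i, 1 / δ i < N := by
    obtain ⟨M, hM⟩ := Set.finite_range (fun i => 1 / δ i) |>.bddAbove
    obtain ⟨N, hN⟩ := exists_nat_gt M
    exact ⟨N, fun i => (hM ⟨i, rfl⟩).trans_lt hN⟩
  set k := N + 1 with hk
  have hkpos : (0 : ℝ) < k := by rw [hk]; positivity
  have hkδ : ∀ i, 1 / (k : ℝ) < δ i := by
    intro i
    rw [div_lt_iff₀ hkpos, mul_comm, ← div_lt_iff₀ (hδ i)]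
    refine (hN i).trans ?_
    rw [hk]; push_cast; linarith
  obtain ⟨x, hx⟩ := discrete_pm k n
    (fun i u => if 0 < F i (fun c => (u c : ℝ) / k) then 1 else 0)
    (fun i u hu => if_neg (not_lt.2 (h0 i _ (by simp [hu]))))
    (fun i u hu => if_pos (h1 i _ (by simp [hu, hkpos.ne'])))
  have hmem : ∀ u : Fin n → ℕ, (∀ c, (x c : ℕ) ≤ u c ∧ u c ≤ x c + 1) →
      (fun c => (u c : ℝ) / k) ∈ Set.Icc (0 : Fin n → ℝ) 1 := by
    intro u hu
    refine ⟨fun c => ?_, fun c => ?_⟩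
    · simp only [Pi.zero_apply]; positivity
    · simp only [Pi.one_apply]
      rw [div_le_one hkpos]
      exact_mod_cast (hu c).2.trans (x c).2
  have hdist : ∀ i, ∀ u : Fin n → ℕ, (∀ c, (x c : ℕ) ≤ u c ∧ u c ≤ x c + 1) →
      dist (fun c => ((x c : ℕ) : ℝ) / k) (fun c => (u c : ℝ) / k) < δ i := by
    intro i u hu
    refine lt_of_le_of_lt ((dist_pi_le_iff (by positivity)).2 fun c => ?_) (hkδ i)
    have a1 : ((x c : ℕ) : ℝ) ≤ u c := by exact_mod_cast (hu c).1
    have a2 : (u c : ℝ) ≤ (x c : ℕ) + 1 := by exact_mod_cast (hu c).2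
    rw [Real.dist_eq, ← sub_div, abs_div, abs_of_pos hkpos]
    gcongr
    rw [abs_le]; constructor <;> linarith
  have hx0 := hmem (fun c => x c) (fun c => ⟨le_rfl, Nat.le_succ _⟩)
  have hsmall : ∀ i, |F i (fun c => ((x c : ℕ) : ℝ) / k)| ≤ η := by
    intro i
    obtain ⟨u, w, huw, hu, hw⟩ := hx i
    have d1 := hδF i _ hx0 _ (hmem u hu) (hdist i u hu)
    have d2 := hδF i _ hx0 _ (hmem w hw) (hdist i w hw)
    rw [Real.dist_eq, abs_lt] at d1 d2
    rw [abs_le]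
    by_cases c1 : 0 < F i (fun c => (u c : ℝ) / k) <;>
    by_cases c2 : 0 < F i (fun c => (w c : ℝ) / k)
    · simp [c1, c2] at huw
    · constructor <;> linarith
    · constructor <;> linarith
    · simp [c1, c2] at huw
  have hle : ε ≤ ∑ i, |F i (fun c => ((x c : ℕ) : ℝ) / k)| := hmin hx0
  have : ∑ i, |F i (fun c => ((x c : ℕ) : ℝ) / k)| ≤ n * η := by
    refine (Finset.sum_le_card_nsmul _ _ η fun i _ => hsmall i).trans ?_
    simp
  have h3 : (n + 1) * η = ε := by rw [hη]; field_simp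
  linarith

/-- compact set with no component joining `A` and `B` can be split -/
theorem split_compact {E : Type*} [TopologicalSpace E] [T2Space E] (K A B : Set E) (hK : IsCompact K)
    (hA : IsClosed A) (hB : IsClosed B)
    (h : ∀ y ∈ K, ¬ ((connectedComponentIn K y ∩ A).Nonempty ∧ (connectedComponentIn K y ∩ B).Nonempty)) :
    ∃ U V : Set E, IsClosed U ∧ IsClosed V ∧ U ⊆ K ∧ V ⊆ K ∧ K ⊆ U ∪ V ∧ Disjoint U V ∧
      Disjoint U B ∧ Disjoint V A := by
  have : CompactSpace K := isCompact_iff_compactSpace.1 hK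
  let q : K → ConnectedComponents K := (↑)
  have hq : Continuous q := ConnectedComponents.continuous_coe
  have hA' : IsClosed (q '' (Subtype.val ⁻¹' A)) :=
    ((hA.preimage continuous_subtype_val).isCompact.image hq).isClosed
  have hB' : IsClosed (q '' (Subtype.val ⁻¹' B)) :=
    ((hB.preimage continuous_subtype_val).isCompact.image hq).isClosed
  have hsub : q '' (Subtype.val ⁻¹' A) ⊆ (q '' (Subtype.val ⁻¹' B))ᶜ := by
    rintro _ ⟨a, ha, rfl⟩ ⟨b, hb, hab⟩
    have hab' : connectedComponent b = connectedComponent a := ConnectedComponents.coe_eq_coe.1 hab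
    refine h a a.2 ⟨⟨a, mem_connectedComponentIn a.2, ha⟩, ⟨b, ?_, hb⟩⟩
    rw [connectedComponentIn_eq_image a.2]
    refine ⟨b, ?_, rfl⟩
    change b ∈ connectedComponent a
    rw [← hab']; exact mem_connectedComponent
  obtain ⟨C, hC, hAC, hCB⟩ := exists_clopen_of_closed_subset_open hA' hB'.isOpen_compl hsub
  have hC' : IsClopen (q ⁻¹' C) := hC.preimage hq
  refine ⟨Subtype.val '' (q ⁻¹' C), Subtype.val '' (q ⁻¹' C)ᶜ,
    (hC'.1.isCompact.image continuous_subtype_val).isClosed,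
    (hC'.compl.1.isCompact.image continuous_subtype_val).isClosed, ?_, ?_, ?_, ?_, ?_, ?_⟩
  · rintro _ ⟨a, _, rfl⟩; exact a.2
  · rintro _ ⟨a, _, rfl⟩; exact a.2
  · intro a ha
    by_cases hc : (⟨a, ha⟩ : K) ∈ q ⁻¹' C
    · exact Or.inl ⟨_, hc, rfl⟩
    · exact Or.inr ⟨_, hc, rfl⟩
  · exact (Set.disjoint_image_iff Subtype.val_injective).2 disjoint_compl_right
  · rw [Set.disjoint_left]
    rintro _ ⟨a, ha, rfl⟩ hb
    exact hCB ha ⟨a, hb, rfl⟩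
  · rw [Set.disjoint_left]
    rintro _ ⟨a, ha, rfl⟩ hb
    exact ha (hAC ⟨a, hb, rfl⟩)

theorem isCompact_cube (n : ℕ) : IsCompact (Cube n) := by
  have : Cube n = (WithLp.toLp 2) '' (Set.Icc (0 : Fin n → ℝ) 1) := by
    ext x
    constructor
    · intro hx
      exact ⟨WithLp.ofLp x, ⟨fun i => (hx i).1, fun i => (hx i).2⟩, rfl⟩
    · rintro ⟨y, hy, rfl⟩ j
      exact ⟨hy.1 j, hy.2 j⟩
  rw [this]
  exact isCompact_Icc.image (PiLp.continuous_toLp 2 _)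

/-- **`n`-dimensional Hex theorem.** If the cube `[0,1]^n` is covered by `n` closed
sets `X 1, …, X n`, then for some `i` a connected component of `X i` intersects both
opposite facets `{x : x i = 0}` and `{x : x i = 1}`. -/
theorem hex {n : ℕ} (X : Fin n → Set (EuclideanSpace ℝ (Fin n)))
    (hclosed : ∀ i, IsClosed (X i))
    (hcover : Cube n ⊆ ⋃ i, X i) :
    ∃ (i : Fin n) (y : EuclideanSpace ℝ (Fin n)), y ∈ X i ∧
      (connectedComponentIn (X i) y ∩ {x ∈ Cube n | x i = 0}).Nonempty ∧
      (connectedComponentIn (X i) y ∩ {x ∈ Cube n | x i = 1}).Nonempty := by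
  by_contra hcon
  have hpl : ∀ (i : Fin n) (t : ℝ), IsClosed {x : EuclideanSpace ℝ (Fin n) | x i = t} := fun i t =>
    isClosed_eq (by fun_prop) continuous_const
  have hsep : ∀ i : Fin n, ∃ P Q : Set (EuclideanSpace ℝ (Fin n)), IsClosed P ∧ IsClosed Q ∧
      X i ∩ Cube n ⊆ P ∪ Q ∧ Disjoint P Q ∧ {x | x i = 0} ⊆ P ∧ {x | x i = 1} ⊆ Q := by
    intro i
    obtain ⟨U, V, hU, hV, hUK, hVK, hKUV, hUV, hUB, hVA⟩ := split_compact (X i ∩ Cube n)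
      {x | x i = 0} {x | x i = 1} ((isCompact_cube n).inter_left (hclosed i)) (hpl i 0) (hpl i 1) (by
        rintro y hy ⟨⟨a, ha, ha0⟩, ⟨b, hb, hb1⟩⟩
        have hm := connectedComponentIn_mono y (Set.inter_subset_left (s := X i) (t := Cube n))
        exact hcon ⟨i, y, hy.1, ⟨a, hm ha, (connectedComponentIn_subset _ _ ha).2, ha0⟩,
          ⟨b, hm hb, (connectedComponentIn_subset _ _ hb).2, hb1⟩⟩)
    refine ⟨U ∪ {x | x i = 0}, V ∪ {x | x i = 1}, hU.union (hpl i 0), hV.union (hpl i 1), ?_, ?_,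
      Set.subset_union_right, Set.subset_union_right⟩
    · intro x hx
      rcases hKUV hx with h | h
      · exact Or.inl (Or.inl h)
      · exact Or.inr (Or.inl h)
    · rw [Set.disjoint_union_left, Set.disjoint_union_right, Set.disjoint_union_right]
      refine ⟨⟨hUV, hUB⟩, hVA.symm, ?_⟩
      rw [Set.disjoint_left]
      intro x h0 h1
      simp only [Set.mem_ofPred_eq] at h0 h1
      rw [h0] at h1; exact zero_ne_one h1
  choose P Q hP hQ hPQ hdis hP0 hQ1 using hsep
  have hPne : ∀ i, (P i).Nonempty := fun i => ⟨WithLp.toLp 2 (fun _ => 0), hP0 i rfl⟩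
  have hQne : ∀ i, (Q i).Nonempty := fun i => ⟨WithLp.toLp 2 (fun _ => 1), hQ1 i rfl⟩
  obtain ⟨x, hx, hx0⟩ := poincare_miranda
    (fun i x => Metric.infDist (WithLp.toLp 2 x) (P i) - Metric.infDist (WithLp.toLp 2 x) (Q i))
    (fun i => ((Metric.continuous_infDist_pt _).comp (PiLp.continuous_toLp 2 _)).sub
      ((Metric.continuous_infDist_pt _).comp (PiLp.continuous_toLp 2 _)))
    (fun i x hx => by
      have : WithLp.toLp 2 x ∈ P i := hP0 i hx
      rw [Metric.infDist_zero_of_mem this]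
      simpa using Metric.infDist_nonneg)
    (fun i x hx => by
      have h1 : WithLp.toLp 2 x ∈ Q i := hQ1 i hx
      have h2 : WithLp.toLp 2 x ∉ P i := fun h => Set.disjoint_left.1 (hdis i) h h1
      rw [Metric.infDist_zero_of_mem h1, sub_zero]
      exact ((hP i).notMem_iff_infDist_pos (hPne i)).1 h2)
  have hxc : WithLp.toLp 2 x ∈ Cube n := fun j => ⟨hx.1 j, hx.2 j⟩
  obtain ⟨i, hi⟩ := Set.mem_iUnion.1 (hcover hxc)
  have h0 := sub_eq_zero.1 (hx0 i)
  rcases hPQ i ⟨hi, hxc⟩ with h | h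
  · rw [Metric.infDist_zero_of_mem h] at h0
    exact Set.disjoint_left.1 (hdis i) h (((hQ i).mem_iff_infDist_zero (hQne i)).2 h0.symm)
  · rw [Metric.infDist_zero_of_mem h] at h0
    exact Set.disjoint_left.1 (hdis i) (((hP i).mem_iff_infDist_zero (hPne i)).2 h0) h
end

section
/- (Colorful Voronoi-Hex game is always decided) Let S ⊆ ℝ^n be a finite nonempty set and for x ∈ S let V_x = {y ∈ ℝ^n : ‖y − x‖ ≤ ‖y − z‖ for all z ∈ S} be its Voronoi cell. Let P ⊆ ℝ^n be a full-dimensional simple convex polytope with a proper coloring h of its facets by n colors, let V be a vertex of P, and for each i ∈ {1,…,n} let F_{ν_i} be the unique facet containing V with h(F_{ν_i}) = i. Then for every assignment c : S → {1,…,n} of colors to the points of S there exist a color i and a connected component Y of P ∩ (⋃_{x ∈ S, c(x) = i} V_x) such that Y intersects both F_{ν_i} and some other facet F ≠ F_{ν_i} of P with h(F) = i. -/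
open Set

noncomputable section

/-- A full-dimensional convex polytope in `ℝ^d`: the convex hull of a finite
set of points, with nonempty interior. -/
def IsPolytope {d : ℕ} (P : Set (EuclideanSpace ℝ (Fin d))) : Prop :=
  (∃ S : Finset (EuclideanSpace ℝ (Fin d)),
    P = convexHull ℝ (S : Set (EuclideanSpace ℝ (Fin d)))) ∧ (interior P).Nonempty

/-- A face of `P` is an exposed face: the set of points of `P` at which some
linear functional attains its maximum over `P`. -/
def IsFaceOf {d : ℕ} (P F : Set (EuclideanSpace ℝ (Fin d))) : Prop :=
  ∃ l : EuclideanSpace ℝ (Fin d) →L[ℝ] ℝ, F = {x ∈ P | ∀ y ∈ P, l y ≤ l x}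

/-- The dimension of a subset of `ℝ^d`: the dimension of its affine span. -/
noncomputable def faceDim {d : ℕ} (F : Set (EuclideanSpace ℝ (Fin d))) : ℕ :=
  Module.finrank ℝ (affineSpan ℝ F).direction

/-- A facet is a face of dimension `d - 1`. -/
def IsFacetOf {d : ℕ} (P F : Set (EuclideanSpace ℝ (Fin d))) : Prop :=
  IsFaceOf P F ∧ faceDim F = d - 1

/-- A vertex is a (zero-dimensional) face consisting of a single point. -/
def IsVertexOf {d : ℕ} (P : Set (EuclideanSpace ℝ (Fin d)))
    (v : EuclideanSpace ℝ (Fin d)) : Prop :=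
  IsFaceOf P {v}

/-- A polytope is simple if every vertex is contained in exactly `d` facets. -/
def IsSimplePolytope {d : ℕ} (P : Set (EuclideanSpace ℝ (Fin d))) : Prop :=
  IsPolytope P ∧ ∀ v, IsVertexOf P v → {F | IsFacetOf P F ∧ v ∈ F}.ncard = d

/-- A proper coloring of the facets of `P` by `k` colors: distinct facets with
nonempty intersection receive different colors. -/
def IsProperColoring {d k : ℕ} (P : Set (EuclideanSpace ℝ (Fin d)))
    (h : Set (EuclideanSpace ℝ (Fin d)) → Fin k) : Prop :=
  ∀ F₁ F₂, IsFacetOf P F₁ → IsFacetOf P F₂ → F₁ ≠ F₂ → (F₁ ∩ F₂).Nonempty →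
    h F₁ ≠ h F₂

/-- The Voronoi cell of a point `x` of a finite set `S ⊆ ℝ^n`: all points at least as
close to `x` as to every point of `S`. -/
def VorCell {n : ℕ} (S : Finset (EuclideanSpace ℝ (Fin n)))
    (x : EuclideanSpace ℝ (Fin n)) : Set (EuclideanSpace ℝ (Fin n)) :=
  {y | ∀ z ∈ S, dist y x ≤ dist y z}

/-- `det (1 + t A)` is a polynomial in `t`. -/
lemma det_poly {n : ℕ} (A : EuclideanSpace ℝ (Fin n) →L[ℝ] EuclideanSpace ℝ (Fin n)) :
    ∃ p : Polynomial ℝ, p.natDegree ≤ n ∧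
      ∀ t : ℝ, p.eval t = (ContinuousLinearMap.id ℝ _ + t • A).det := by
  classical
  let b := (EuclideanSpace.basisFun (Fin n) ℝ).toBasis
  let M := LinearMap.toMatrix b b (A : EuclideanSpace ℝ (Fin n) →ₗ[ℝ] EuclideanSpace ℝ (Fin n))
  refine ⟨Matrix.det ((Polynomial.X : Polynomial ℝ) • M.map Polynomial.C +
    (1 : Matrix (Fin n) (Fin n) ℝ).map Polynomial.C), ?_, ?_⟩
  · simpa using Polynomial.natDegree_det_X_add_C_le M 1
  · intro t
    rw [ContinuousLinearMap.det, ← LinearMap.det_toMatrix b, ← Polynomial.coe_evalRingHom,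
      RingHom.map_det]
    congr 1
    ext i j
    simp [M, b, LinearMap.toMatrix_apply, Matrix.one_apply, add_comm]
    split_ifs <;> simp_all [mul_comm]

lemma det_pos_of_small {n : ℕ} (A : EuclideanSpace ℝ (Fin n) →L[ℝ] EuclideanSpace ℝ (Fin n))
    (t : ℝ) (ht : 0 ≤ t) (hA : t * ‖A‖ < 1) :
    0 < (ContinuousLinearMap.id ℝ _ + t • A).det := by
  obtain ⟨p, -, hp⟩ := det_poly A
  by_contra hcon
  push Not at hcon
  have h0 : p.eval 0 = 1 := by rw [hp]; simp [ContinuousLinearMap.det]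
  have hc : ContinuousOn (fun s => p.eval s) (Icc 0 t) := p.continuous.continuousOn
  have := intermediate_value_Icc' ht hc
  obtain ⟨s, hs, hs0⟩ := this (show (0:ℝ) ∈ Icc (p.eval t) (p.eval 0) from
    ⟨by rw [hp]; exact hcon, by rw [h0]; norm_num⟩)
  simp only [hp] at hs0
  have hlt := LinearMap.bot_lt_ker_of_det_eq_zero hs0
  obtain ⟨v, hv, hv0⟩ := (Submodule.ne_bot_iff _).1 hlt.ne'
  have h1 : v + s • A v = 0 := by simpa using hv
  have h2 : ‖v‖ ≤ s * (‖A‖ * ‖v‖) := by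
    have : v = - (s • A v) := eq_neg_of_add_eq_zero_left h1
    calc ‖v‖ = ‖s • A v‖ := by rw [← norm_neg (s • A v), ← this]
      _ = s * ‖A v‖ := by rw [norm_smul, Real.norm_of_nonneg hs.1]
      _ ≤ _ := by gcongr; exact hs.1; exact A.le_opNorm v
  have h3 : 0 < ‖v‖ := norm_pos_iff.2 hv0
  have h4 : s * ‖A‖ ≤ t * ‖A‖ := by gcongr; exact hs.2
  nlinarith

theorem no_sphere_map {n : ℕ} (G : EuclideanSpace ℝ (Fin n) → EuclideanSpace ℝ (Fin n))
    (hG : ContDiff ℝ 1 G) (R : ℝ) (hR : 0 < R) (h1 : ∀ x, ‖G x‖ = R)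
    (h2 : ∀ x, ‖x‖ = R → G x = x) : False := by
  classical
  set B : Set (EuclideanSpace ℝ (Fin n)) := Metric.closedBall 0 R with hB
  have hBc : IsCompact B := isCompact_closedBall 0 R
  have hBconv : Convex ℝ B := convex_closedBall 0 R
  set k₀ : EuclideanSpace ℝ (Fin n) → EuclideanSpace ℝ (Fin n) := fun x => G x - x with hk₀
  have hk₀d : ContDiff ℝ 1 k₀ := hG.sub contDiff_id
  have hcd : Continuous (fderiv ℝ k₀) := hk₀d.continuous_fderiv one_ne_zero
  obtain ⟨K, hK⟩ : ∃ K, ∀ x ∈ B, ‖fderiv ℝ k₀ x‖ ≤ K :=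
    hBc.exists_bound_of_continuousOn hcd.continuousOn
  have hK0 : 0 ≤ K := (norm_nonneg _).trans (hK 0 (by simp [hB, hR.le]))
  have hlip : ∀ x ∈ B, ∀ y ∈ B, ‖k₀ y - k₀ x‖ ≤ K * ‖y - x‖ := fun x hx y hy =>
    Convex.norm_image_sub_le_of_norm_fderiv_le
      (fun z _ => (hk₀d.differentiable one_ne_zero) z) hK hBconv hx hy
  let k : EuclideanSpace ℝ (Fin n) → EuclideanSpace ℝ (Fin n) := fun x => if x ∈ B then k₀ x else 0
  have kin : ∀ x ∈ B, k x = k₀ x := fun x hx => if_pos hx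
  have kout : ∀ x ∉ B, k x = 0 := fun x hx => if_neg hx
  have hmix : ∀ x ∈ B, ∀ y ∉ B, ‖k y - k x‖ ≤ K * ‖y - x‖ := by
    intro x hx y hy
    have hxR : ‖x‖ ≤ R := by simpa [hB] using hx
    have hyR : R ≤ ‖y‖ := by
      have : ¬ ‖y‖ ≤ R := by simpa [hB] using hy
      linarith
    have hc : ContinuousOn (fun s : ℝ => ‖x + s • (y - x)‖) (Icc 0 1) := by fun_prop
    obtain ⟨s, hs, hsR⟩ := intermediate_value_Icc (zero_le_one) hc
      (show R ∈ Icc _ _ from ⟨by simpa using hxR, by simpa using hyR⟩)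
    have hz : x + s • (y - x) ∈ B := by simp [hB, hsR.le]
    have hkz : k₀ (x + s • (y - x)) = 0 := by simp [hk₀, h2 _ hsR]
    have := hlip x hx _ hz
    rw [kin x hx, kout y hy]
    rw [hkz] at this
    refine this.trans ?_
    gcongr
    rw [add_sub_cancel_left, norm_smul, Real.norm_of_nonneg hs.1]
    exact mul_le_of_le_one_left (norm_nonneg _) hs.2
  have hklip : ∀ x y, ‖k y - k x‖ ≤ K * ‖y - x‖ := by
    intro x y
    by_cases hx : x ∈ B <;> by_cases hy : y ∈ B
    · rw [kin x hx, kin y hy]; exact hlip x hx y hy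
    · exact hmix x hx y hy
    · rw [norm_sub_rev, norm_sub_rev y]; exact hmix y hy x hx
    · rw [kout x hx, kout y hy]; simp; positivity
  -- small parameters give a homeomorphism of the ball
  have hsmall : ∀ t : ℝ, 0 ≤ t → t * K < 1 →
      ∫ x in B, (ContinuousLinearMap.id ℝ _ + t • fderiv ℝ k₀ x).det = MeasureTheory.volume.real B := by
    intro t ht htK
    let Φ : EuclideanSpace ℝ (Fin n) → EuclideanSpace ℝ (Fin n) := fun x => x + t • k x
    have hinj : Function.Injective Φ := by
      intro x y hxy
      have h3 : y - x = - (t • (k y - k x)) := by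
        have : x + t • k x = y + t • k y := hxy
        rw [smul_sub]
        rw [neg_sub, sub_eq_sub_iff_add_eq_add, ← this, add_comm]
      have h4 : ‖y - x‖ ≤ t * (K * ‖y - x‖) := by
        conv_lhs => rw [h3, norm_neg, norm_smul, Real.norm_of_nonneg ht]
        gcongr
        exact hklip x y
      have h5 : ‖y - x‖ = 0 := by
        by_contra hne
        have : 0 < ‖y - x‖ := lt_of_le_of_ne (norm_nonneg _) (Ne.symm hne)
        nlinarith
      exact (sub_eq_zero.1 (norm_eq_zero.1 h5)).symm
    have hsurj : Function.Surjective Φ := by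
      intro y
      have hcon : ContractingWith (Real.toNNReal (t * K)) (fun x => y - t • k x) := by
        refine ⟨by rw [← NNReal.coe_lt_coe]; simpa using htK, ?_⟩
        refine LipschitzWith.of_dist_le_mul fun a b => ?_
        rw [Real.coe_toNNReal _ (by positivity), dist_eq_norm, dist_eq_norm]
        have : y - t • k a - (y - t • k b) = t • (k b - k a) := by rw [smul_sub]; abel
        rw [this, norm_smul, Real.norm_of_nonneg ht, mul_assoc, norm_sub_rev a b]
        gcongr
        exact hklip a b
      refine ⟨hcon.fixedPoint, ?_⟩
      have := hcon.fixedPoint_isFixedPt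
      have h6 : y - t • k hcon.fixedPoint = hcon.fixedPoint := this
      show hcon.fixedPoint + t • k hcon.fixedPoint = y
      rw [← eq_sub_iff_add_eq, h6]
    have himg : Φ '' B = B := by
      have hc : Φ '' Bᶜ = Bᶜ := by
        have : EqOn Φ id Bᶜ := fun x hx => by simp [Φ, kout x hx]
        rw [this.image_eq, image_id]
      have := image_compl_eq ⟨hinj, hsurj⟩ (s := B)
      rw [hc] at this
      exact (compl_injective this).symm
    have hder : ∀ x ∈ B, HasFDerivWithinAt Φ
        (ContinuousLinearMap.id ℝ _ + t • fderiv ℝ k₀ x) B x := by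
      intro x hx
      have hd : HasFDerivAt k₀ (fderiv ℝ k₀ x) x :=
        ((hk₀d.differentiable one_ne_zero) x).hasFDerivAt
      have : HasFDerivAt (fun x => x + t • k₀ x) (ContinuousLinearMap.id ℝ _ + t • fderiv ℝ k₀ x) x :=
        (hasFDerivAt_id x).add (hd.const_smul t)
      refine this.hasFDerivWithinAt.congr (fun y hy => ?_) ?_
      · simp [Φ, kin y hy]
      · simp [Φ, kin x hx]
    have hcv := MeasureTheory.integral_image_eq_integral_abs_det_fderiv_smul
      MeasureTheory.volume hBc.measurableSet hder hinj.injOn (fun _ => (1:ℝ))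
    rw [himg] at hcv
    simp only [smul_eq_mul, mul_one, MeasureTheory.setIntegral_const] at hcv
    rw [hcv]
    refine MeasureTheory.setIntegral_congr_fun hBc.measurableSet fun x hx => ?_
    refine (abs_of_pos (det_pos_of_small _ t ht ?_)).symm
    exact lt_of_le_of_lt (by gcongr; exact hK x hx) htK
  -- polynomial dependence
  obtain ⟨δ, hδ, hδK⟩ : ∃ δ : ℝ, 0 < δ ∧ δ * (n + 1) * K < 1 := by
    refine ⟨1 / ((n+1) * (K + 1)), by positivity, ?_⟩
    field_simp
    linarith
  choose p hpd hpe using fun x => det_poly (fderiv ℝ k₀ x)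
  let s := Finset.range (n + 1)
  let v : ℕ → ℝ := fun j => δ * j
  have hvs : Set.InjOn v s := fun a _ b _ hab => by
    have : δ * a = δ * b := hab
    have := mul_left_cancel₀ hδ.ne' this
    exact_mod_cast this
  have hinterp : ∀ q : Polynomial ℝ, q.natDegree ≤ n →
      q.eval 1 = ∑ j ∈ s, q.eval (v j) * (Lagrange.basis s v j).eval 1 := by
    intro q hq
    have hdeg : q.degree < s.card := by
      rw [Finset.card_range]
      exact lt_of_le_of_lt Polynomial.degree_le_natDegree (by exact_mod_cast Nat.lt_succ_of_le hq)
    conv_lhs => rw [Lagrange.eq_interpolate hvs hdeg]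
    simp [Lagrange.interpolate_apply, Polynomial.eval_finsetSum]
  have hcont : ∀ t : ℝ, Continuous fun x => (ContinuousLinearMap.id ℝ _ + t • fderiv ℝ k₀ x).det := by
    intro t
    exact ContinuousLinearMap.continuous_det.comp (continuous_const.add (hcd.const_smul t))
  have hone : ∫ x in B, (ContinuousLinearMap.id ℝ _ + (1:ℝ) • fderiv ℝ k₀ x).det
      = MeasureTheory.volume.real B := by
    have e1 : ∀ x, (ContinuousLinearMap.id ℝ _ + (1:ℝ) • fderiv ℝ k₀ x).det =
        ∑ j ∈ s, (ContinuousLinearMap.id ℝ _ + (v j) • fderiv ℝ k₀ x).det *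
          (Lagrange.basis s v j).eval 1 := by
      intro x
      simp only [← hpe]
      exact hinterp _ (hpd x)
    simp only [e1]
    rw [MeasureTheory.integral_finsetSum]
    · have e2 := hinterp 1 (by simp)
      simp only [Polynomial.eval_one, one_mul] at e2
      calc _ = ∑ j ∈ s, MeasureTheory.volume.real B * (Lagrange.basis s v j).eval 1 := by
            refine Finset.sum_congr rfl fun j hj => ?_
            rw [MeasureTheory.integral_mul_const, hsmall]
            · positivity
            · have : (j:ℝ) ≤ n + 1 := by
                have := Finset.mem_range.1 hj
                exact_mod_cast this.le
              refine lt_of_le_of_lt ?_ hδK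
              simp only [v]
              gcongr
        _ = _ := by rw [← Finset.mul_sum, ← e2, mul_one]
    · intro j _
      exact (((hcont (v j)).continuousOn).integrableOn_compact hBc).mul_const _
  have hzero : ∀ x, (ContinuousLinearMap.id ℝ _ + (1:ℝ) • fderiv ℝ k₀ x).det = 0 := by
    intro x
    have hd : HasFDerivAt G (ContinuousLinearMap.id ℝ _ + (1:ℝ) • fderiv ℝ k₀ x) x := by
      have h3 : HasFDerivAt k₀ (fderiv ℝ k₀ x) x :=
        ((hk₀d.differentiable one_ne_zero) x).hasFDerivAt
      have := (hasFDerivAt_id x).add h3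
      rw [one_smul]
      refine this.congr_of_eventuallyEq (Filter.Eventually.of_forall fun y => ?_)
      simp [hk₀]
    set D := (ContinuousLinearMap.id ℝ (EuclideanSpace ℝ (Fin n)) + (1:ℝ) • fderiv ℝ k₀ x)
    by_contra hne
    have hsq := hd.norm_sq
    have hcst : HasFDerivAt (fun y => ‖G y‖ ^ 2) (0 : EuclideanSpace ℝ (Fin n) →L[ℝ] ℝ) x := by
      simp only [h1]
      exact hasFDerivAt_const _ _
    have heq := hsq.unique hcst
    have hsurj : Function.Surjective D := by
      have := ((LinearMap.equivOfDetNeZero _ hne)).surjective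
      exact this
    obtain ⟨w, hw⟩ := hsurj (G x)
    have := DFunLike.congr_fun heq w
    simp [hw, h1 x] at this
    exact hR.ne' this
  simp only [hzero, MeasureTheory.integral_zero] at hone
  have hpos : 0 < MeasureTheory.volume.real B := by
    rw [MeasureTheory.measureReal_def]
    exact ENNReal.toReal_pos (Metric.measure_closedBall_pos _ _ hR).ne' hBc.measure_lt_top.ne
  linarith

theorem surj_of_eq_id_outside {n : ℕ} (H : EuclideanSpace ℝ (Fin n) → EuclideanSpace ℝ (Fin n))
    (hH : Continuous H) (K : Set (EuclideanSpace ℝ (Fin n))) (hK : Bornology.IsBounded K)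
    (hid : ∀ x ∉ K, H x = x) : ∃ x, H x = 0 := by
  by_contra! hne
  have hf : Continuous fun x => H x - x := hH.sub continuous_id
  obtain ⟨g, hg, hgd, hgs⟩ := hf.exists_contDiff_approx 1 hH.norm (fun x => norm_pos_iff.2 (hne x))
  obtain ⟨R, hR, hKR⟩ := hK.subset_ball_lt 0 0
  have hF0 : ∀ x, x + g x ≠ 0 := by
    intro x hx
    have := hgd x
    rw [dist_eq_norm, show g x - (H x - x) = (x + g x) - H x by abel, hx, zero_sub, norm_neg] at this
    exact lt_irrefl _ this
  have hFc : ContDiff ℝ 1 fun x => x + g x := contDiff_id.add hg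
  refine no_sphere_map (fun x => (R / ‖x + g x‖) • (x + g x)) ?_ R hR ?_ ?_
  · exact (contDiff_const.div (hFc.norm ℝ hF0) fun x => norm_ne_zero_iff.2 (hF0 x)).smul hFc
  · intro x
    have := norm_pos_iff.2 (hF0 x)
    rw [norm_smul, Real.norm_of_nonneg (by positivity)]
    field_simp
  · intro x hx
    have hxK : x ∉ K := fun h => by
      have := hKR h
      simp [hx] at this
    have : g x = 0 := by
      by_contra hgx
      have := hgs hgx
      simp [hid x hxK] at this
    simp [this, hx, hR.ne']
lemma crossing {X : Type*} [TopologicalSpace X] {P s : Set X} (hP : IsClosed P)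
    (hs : IsPreconnected s) (h1 : (s ∩ interior P).Nonempty) (h2 : (s ∩ Pᶜ).Nonempty) :
    (s ∩ frontier P).Nonempty := by
  by_contra hcon
  have hsub : s ⊆ interior P ∪ Pᶜ := by
    intro x hx
    by_contra hx'
    simp only [mem_union, mem_compl_iff, not_or, not_not] at hx'
    exact hcon ⟨x, hx, subset_closure hx'.2, hx'.1⟩
  obtain ⟨x, -, hx1, hx2⟩ := hs _ _ isOpen_interior hP.isOpen_compl hsub h1 h2
  exact hx2 (interior_subset hx1)

/-- A face of a polytope is contained in the affine span of the extreme points on it, and equals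
the closed convex hull of them. -/
lemma face_eq {n : ℕ} {P F : Set (EuclideanSpace ℝ (Fin n))} (hPc : IsCompact P)
    (hPv : Convex ℝ P) (hF : IsFaceOf P F) :
    F = closure (convexHull ℝ (F ∩ P.extremePoints ℝ)) := by
  obtain ⟨l, hl⟩ := hF
  have hexp : IsExposed ℝ P F := fun _ => ⟨l, hl⟩
  have hc : IsCompact F := hexp.isCompact hPc
  have hv : Convex ℝ F := hexp.convex hPv
  rw [← hexp.isExtreme.extremePoints_eq, closure_convexHull_extremePoints hc hv]

lemma face_closed {n : ℕ} {P F : Set (EuclideanSpace ℝ (Fin n))} (hPc : IsCompact P)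
    (hF : IsFaceOf P F) : IsCompact F := by
  obtain ⟨l, hl⟩ := hF
  have hexp : IsExposed ℝ P F := fun _ => ⟨l, hl⟩
  exact hexp.isCompact hPc

lemma polytope_compact {n : ℕ} {P : Set (EuclideanSpace ℝ (Fin n))} (hP : IsPolytope P) :
    IsCompact P := by
  obtain ⟨⟨S, rfl⟩, -⟩ := hP
  exact S.finite_toSet.isCompact_convexHull (𝕜 := ℝ)

lemma polytope_convex {n : ℕ} {P : Set (EuclideanSpace ℝ (Fin n))} (hP : IsPolytope P) :
    Convex ℝ P := by
  obtain ⟨⟨S, rfl⟩, -⟩ := hP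
  exact convex_convexHull ℝ _

lemma polytope_ext_finite {n : ℕ} {P : Set (EuclideanSpace ℝ (Fin n))} (hP : IsPolytope P) :
    (P.extremePoints ℝ).Finite := by
  obtain ⟨⟨S, rfl⟩, -⟩ := hP
  exact S.finite_toSet.subset extremePoints_convexHull_subset

lemma faces_finite {n : ℕ} {P : Set (EuclideanSpace ℝ (Fin n))} (hP : IsPolytope P) :
    {F | IsFaceOf P F}.Finite := by
  refine Set.Finite.of_finite_image
    (f := fun F => F ∩ P.extremePoints ℝ) ((polytope_ext_finite hP).finite_subsets.subset ?_) ?_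
  · rintro _ ⟨F, -, rfl⟩
    exact inter_subset_right
  · intro F hF F' hF' h
    have h' : F ∩ P.extremePoints ℝ = F' ∩ P.extremePoints ℝ := h
    rw [face_eq (polytope_compact hP) (polytope_convex hP) hF,
      face_eq (polytope_compact hP) (polytope_convex hP) hF', h']

lemma facets_finite {n : ℕ} {P : Set (EuclideanSpace ℝ (Fin n))} (hP : IsPolytope P) :
    {F | IsFacetOf P F}.Finite :=
  (faces_finite hP).subset fun _ h => h.1

/-- A point of the frontier which avoids low dimensional spans lies in a facet. -/
lemma mem_facet_of_generic {n : ℕ} {P : Set (EuclideanSpace ℝ (Fin n))} (hP : IsPolytope P)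
    {p y : EuclideanSpace ℝ (Fin n)} (hp : p ∈ interior P) (hy : y ∈ P) (hyi : y ∉ interior P)
    (hgen : ∀ T ⊆ P.extremePoints ℝ, y ∈ affineSpan ℝ T → affineSpan ℝ (insert p T) = ⊤) :
    ∃ F, IsFacetOf P F ∧ y ∈ F := by
  have hPv := polytope_convex hP
  have hPc := polytope_compact hP
  obtain ⟨l, hl⟩ := geometric_hahn_banach_open_point hPv.interior isOpen_interior hyi
  have hcl : closure (interior P) = P := by
    rw [hPv.closure_interior_eq_closure_of_nonempty_interior ⟨p, hp⟩, hPc.isClosed.closure_eq]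
  have hle : ∀ a ∈ P, l a ≤ l y := by
    intro a ha
    rw [← hcl] at ha
    have : closure (interior P) ⊆ {a | l a ≤ l y} :=
      closure_minimal (fun a ha => (hl a ha).le) (isClosed_le l.continuous continuous_const)
    exact this ha
  set F := {x ∈ P | ∀ y ∈ P, l y ≤ l x} with hF
  have hface : IsFaceOf P F := ⟨l, rfl⟩
  have hyF : y ∈ F := ⟨hy, hle⟩
  refine ⟨F, ⟨hface, ?_⟩, hyF⟩
  set T := F ∩ P.extremePoints ℝ with hT
  have hyT : y ∈ affineSpan ℝ T := by
    have h1 := face_eq hPc hPv hface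
    have h2 : closure (convexHull ℝ T) ⊆ affineSpan ℝ T :=
      closure_minimal (convexHull_subset_affineSpan T)
        (AffineSubspace.closed_of_finiteDimensional _)
    rw [h1] at hyF
    exact h2 hyF
  have htop := hgen T inter_subset_right hyT
  have h1 : n ≤ faceDim F + 1 := by
    have h2 := finrank_vectorSpan_insert_le_set ℝ T p
    rw [← direction_affineSpan, htop, AffineSubspace.direction_top, finrank_top,
      finrank_euclideanSpace_fin] at h2
    refine h2.trans ?_
    gcongr
    rw [faceDim, direction_affineSpan]
    exact Submodule.finrank_mono (vectorSpan_mono ℝ inter_subset_left)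
  have h3 : faceDim F + 1 ≤ n := by
    have h4 : (affineSpan ℝ F).direction ≤ LinearMap.ker (l : EuclideanSpace ℝ (Fin n) →ₗ[ℝ] ℝ) := by
      rw [direction_affineSpan, vectorSpan_def, Submodule.span_le]
      rintro _ ⟨a, ha, b, hb, rfl⟩
      have : l a = l b := le_antisymm (hb.2 a ha.1) (ha.2 b hb.1)
      simp [this]
    have h5 : LinearMap.ker (l : EuclideanSpace ℝ (Fin n) →ₗ[ℝ] ℝ) < ⊤ := by
      rw [lt_top_iff_ne_top]
      intro h6
      have h7 : ∀ v, l v = 0 := fun v => by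
        have : v ∈ LinearMap.ker (l : EuclideanSpace ℝ (Fin n) →ₗ[ℝ] ℝ) := by rw [h6]; trivial
        simpa using this
      have := hl p hp
      simp [h7] at this
    have h8 := Submodule.finrank_lt h5.ne
    have h9 := Submodule.finrank_mono h4
    rw [finrank_euclideanSpace_fin] at h8
    rw [faceDim]
    omega
  omega

/-- Every boundary point of a polytope lies in a facet. -/
lemma mem_facet {n : ℕ} {P : Set (EuclideanSpace ℝ (Fin n))} (hP : IsPolytope P)
    {x : EuclideanSpace ℝ (Fin n)} (hx : x ∈ P) (hxi : x ∉ interior P) :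
    ∃ F, IsFacetOf P F ∧ x ∈ F := by
  by_contra hcon
  have hPv := polytope_convex hP
  have hPc := polytope_compact hP
  obtain ⟨p, hp⟩ := hP.2
  -- the union of facets is closed
  have hKc : IsClosed (⋃ F ∈ {F | IsFacetOf P F}, F) :=
    (facets_finite hP).isClosed_biUnion fun F hF => (face_closed hPc hF.1).isClosed
  have hxK : x ∈ (⋃ F ∈ {F | IsFacetOf P F}, F)ᶜ := by
    simp only [mem_compl_iff, mem_iUnion, not_exists]
    intro F hF hxF
    exact hcon ⟨F, hF, hxF⟩
  obtain ⟨r, hr, hball⟩ := Metric.isOpen_iff.1 hKc.isOpen_compl x hxK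
  have hxp : x ≠ p := fun h => hxi (h ▸ hp)
  have hnorm : 0 < ‖x - p‖ := norm_pos_iff.2 (sub_ne_zero.2 hxp)
  -- choose η
  obtain ⟨η, hη0, hη1, hηr⟩ : ∃ η : ℝ, 0 < η ∧ η < 1 ∧ η * ‖x - p‖ < r := by
    refine ⟨min (1/2) (r / (2 * ‖x - p‖)), by positivity, ?_, ?_⟩
    · exact (min_le_left _ _).trans_lt (by norm_num)
    · calc _ ≤ r / (2 * ‖x - p‖) * ‖x - p‖ := by gcongr; exact min_le_right _ _
        _ = r / 2 := by field_simp
        _ < r := by linarith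
  set q := (1 - η) / (1 + η) with hq
  have hq0 : 0 < q := div_pos (by linarith) (by linarith)
  have hq1 : q < 1 := by rw [hq, div_lt_one (by linarith)]; linarith
  let W : Set (EuclideanSpace ℝ (Fin n)) :=
    {z | z ∉ P ∧ z ∈ Metric.ball x r ∧ p + q • (z - p) ∈ interior P ∧
      p + q • (z - p) ∈ Metric.ball x r}
  have hcq : Continuous fun z : EuclideanSpace ℝ (Fin n) => p + q • (z - p) := by fun_prop
  have hWo : IsOpen W := by
    have : W = Pᶜ ∩ (Metric.ball x r ∩ ((fun z => p + q • (z - p)) ⁻¹' interior P ∩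
      (fun z => p + q • (z - p)) ⁻¹' Metric.ball x r)) := by ext; simp [W]
    rw [this]
    exact hPc.isClosed.isOpen_compl.inter (Metric.isOpen_ball.inter
      ((isOpen_interior.preimage hcq).inter (Metric.isOpen_ball.preimage hcq)))
  have hWne : W.Nonempty := by
    refine ⟨p + (1 + η) • (x - p), ?_, ?_, ?_, ?_⟩
    · intro h
      apply hxi
      have hop : x ∈ openSegment ℝ p (p + (1 + η) • (x - p)) := by
        refine ⟨η / (1 + η), 1 / (1 + η), by positivity, by positivity, by field_simp; ring, ?_⟩
        have : 1 + η ≠ 0 := by positivity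
        ext i
        simp
        field_simp
        ring
      exact hPv.openSegment_interior_self_subset_interior hp h hop
    · rw [Metric.mem_ball, dist_eq_norm,
        show p + (1 + η) • (x - p) - x = η • (x - p) by module, norm_smul,
        Real.norm_of_nonneg hη0.le]
      exact hηr
    · have e : p + q • (p + (1 + η) • (x - p) - p) = p + (1 - η) • (x - p) := by
        rw [add_sub_cancel_left, smul_smul, hq, div_mul_cancel₀ _ (by linarith)]
      rw [e]
      apply hPv.openSegment_interior_self_subset_interior hp hx
      exact ⟨η, 1 - η, hη0, by linarith, by ring, by module⟩
    · have e : p + q • (p + (1 + η) • (x - p) - p) = p + (1 - η) • (x - p) := by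
        rw [add_sub_cancel_left, smul_smul, hq, div_mul_cancel₀ _ (by linarith)]
      rw [e, Metric.mem_ball, dist_eq_norm,
        show p + (1 - η) • (x - p) - x = (-η) • (x - p) by module, norm_smul,
        norm_neg, Real.norm_of_nonneg hη0.le]
      exact hηr
  -- a generic point of `W`
  let 𝒯 : Set (Set (EuclideanSpace ℝ (Fin n))) :=
    {T | T ⊆ P.extremePoints ℝ ∧ affineSpan ℝ (insert p T) ≠ ⊤}
  have h𝒯 : 𝒯.Finite := (polytope_ext_finite hP).finite_subsets.subset fun T hT => hT.1
  have hnull : MeasureTheory.volume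
      (⋃ T ∈ 𝒯, (affineSpan ℝ (insert p T) : Set (EuclideanSpace ℝ (Fin n)))) = 0 := by
    rw [MeasureTheory.measure_biUnion_null_iff h𝒯.countable]
    intro T hT
    exact MeasureTheory.Measure.addHaar_affineSubspace _ _ hT.2
  obtain ⟨z, hzW, hzg⟩ : ∃ z ∈ W,
      z ∉ ⋃ T ∈ 𝒯, (affineSpan ℝ (insert p T) : Set (EuclideanSpace ℝ (Fin n))) := by
    by_contra! hsub
    have := MeasureTheory.measure_mono_null hsub hnull
    exact (hWo.measure_pos MeasureTheory.volume hWne).ne' this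
  obtain ⟨hzP, hzb, hqi, hqb⟩ := hzW
  -- crossing point
  have hpre : IsPreconnected ((fun s : ℝ => p + s • (z - p)) '' Icc q 1) :=
    isPreconnected_Icc.image _ (by fun_prop)
  obtain ⟨y, ⟨s, hs, rfl⟩, hyf⟩ : (((fun s : ℝ => p + s • (z - p)) '' Icc q 1) ∩ frontier P).Nonempty := by
    by_contra hemp
    exact hemp (crossing hPc.isClosed hpre
      ⟨_, mem_image_of_mem _ (left_mem_Icc.2 hq1.le), hqi⟩
      ⟨_, mem_image_of_mem _ (right_mem_Icc.2 hq1.le), by simpa using hzP⟩)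
  have hs0 : 0 < s := hq0.trans_le hs.1
  simp only at hyf
  have hyP : p + s • (z - p) ∈ P := hPc.isClosed.frontier_subset hyf
  have hyi : p + s • (z - p) ∉ interior P := hyf.2
  have hyb : p + s • (z - p) ∈ Metric.ball x r := by
    have hseg : p + s • (z - p) ∈ segment ℝ (p + q • (z - p)) z := by
      refine ⟨(1 - s) / (1 - q), (s - q) / (1 - q), div_nonneg (by linarith [hs.2]) (by linarith),
        div_nonneg (by linarith [hs.1]) (by linarith), ?_, ?_⟩
      · have : 1 - q ≠ 0 := by linarith
        field_simp; ring
      · have : 1 - q ≠ 0 := by linarith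
        ext i
        simp
        field_simp
        ring
    exact (convex_ball x r).segment_subset hqb hzb hseg
  obtain ⟨F, hF, hyF⟩ := mem_facet_of_generic hP hp hyP hyi (by
    intro T hT hyT
    by_contra hne
    apply hzg
    simp only [mem_iUnion]
    refine ⟨T, ⟨hT, hne⟩, ?_⟩
    have h1 : p ∈ affineSpan ℝ (insert p T) := subset_affineSpan _ _ (mem_insert _ _)
    have h2 : p + s • (z - p) ∈ affineSpan ℝ (insert p T) :=
      affineSpan_mono ℝ (subset_insert _ _) hyT
    have h3 := AffineMap.lineMap_mem (s⁻¹) h1 h2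
    have h4 : AffineMap.lineMap p (p + s • (z - p)) s⁻¹ = z := by
      rw [AffineMap.lineMap_apply]
      simp [smul_smul, inv_mul_cancel₀ hs0.ne']
    rw [h4] at h3
    exact h3)
  have := hball hyb
  apply this
  simp only [mem_iUnion]
  exact ⟨F, hF, hyF⟩


/-- Homotopy invariance: a map which is nonzero on `P` cannot be linearly homotopic on the boundary
to a homeomorphism having its zero in the interior of `P`. -/
lemma homotopy_contra {n : ℕ} {P : Set (EuclideanSpace ℝ (Fin n))} (hP : IsCompact P)
    (f : EuclideanSpace ℝ (Fin n) → EuclideanSpace ℝ (Fin n)) (hfc : Continuous f)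
    (hf : ∀ y ∈ P, f y ≠ 0) (g : EuclideanSpace ℝ (Fin n) ≃ₜ EuclideanSpace ℝ (Fin n))
    (hg : g.symm 0 ∈ interior P)
    (hb : ∀ y ∈ P, y ∉ interior P → ∀ t ∈ Icc (0:ℝ) 1, (1 - t) • f y + t • g y ≠ 0) : False := by
  have hgc : Continuous g := g.continuous
  let C₀ : Set (EuclideanSpace ℝ (Fin n) × ℝ) :=
    (P ×ˢ Icc (0:ℝ) 1) ∩ {z | (1 - z.2) • f z.1 + z.2 • g z.1 = 0}
  have hC₀ : IsCompact C₀ := by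
    refine (hP.prod isCompact_Icc).inter_right (isClosed_eq ?_ continuous_const)
    fun_prop
  have hC : IsClosed (Prod.fst '' C₀) := (hC₀.image continuous_fst).isClosed
  have hdisj : Disjoint (Prod.fst '' C₀) (interior P)ᶜ := by
    rw [Set.disjoint_left]
    rintro _ ⟨⟨y, t⟩, ⟨⟨hy, ht⟩, h0⟩, rfl⟩ hyi
    exact hb y hy hyi t ht h0
  obtain ⟨χ, hχ0, hχ1, hχ⟩ := exists_continuous_zero_one_of_isClosed hC
    isOpen_interior.isClosed_compl hdisj
  let H : EuclideanSpace ℝ (Fin n) → EuclideanSpace ℝ (Fin n) := fun y =>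
    (1 - χ y) • f y + χ y • g y
  have hHc : Continuous H := by
    have := χ.continuous
    fun_prop
  have hHout : ∀ y ∉ interior P, H y = g y := by
    intro y hy
    have : χ y = 1 := hχ1 hy
    simp [H, this]
  have hHne : ∀ y, H y ≠ 0 := by
    intro y h0
    by_cases hy : y ∈ interior P
    · have : y ∈ Prod.fst '' C₀ := ⟨(y, χ y), ⟨⟨interior_subset hy, hχ y⟩, h0⟩, rfl⟩
      have h1 : χ y = 0 := hχ0 this
      refine hf y (interior_subset hy) ?_
      simpa [H, h1] using h0
    · rw [hHout y hy] at h0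
      apply hy
      rw [← h0, g.symm_apply_apply] at hg
      exact hg
  set y0 := g.symm 0 with hy0
  obtain ⟨x, hx⟩ := surj_of_eq_id_outside (fun x => g.symm (H (x + y0)) - y0)
    ((g.symm.continuous.comp (hHc.comp (continuous_add_const y0))).sub continuous_const)
    ((fun y => y - y0) '' P) (hP.image (by fun_prop)).isBounded (by
      intro x hx
      have : x + y0 ∉ interior P := fun h => hx ⟨x + y0, interior_subset h, by simp⟩
      simp [hHout _ this])
  have h1 : g.symm (H (x + y0)) = g.symm 0 := by rw [sub_eq_zero] at hx; exact hx
  exact hHne _ (g.symm.injective h1)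

/-- For a finite union of closed connected pieces, a union of components is closed. -/
lemma closed_components {X ι : Type*} [TopologicalSpace X] (I : Set ι) (hI : I.Finite)
    (W : ι → Set X) (hWc : ∀ i ∈ I, IsClosed (W i)) (hWp : ∀ i ∈ I, IsPreconnected (W i))
    (Y : Set X) (hY : Y = ⋃ i ∈ I, W i) (Q : Set X → Prop) :
    IsClosed {y ∈ Y | Q (connectedComponentIn Y y)} := by
  have hsub : ∀ i ∈ I, W i ⊆ Y := fun i hi => by rw [hY]; exact subset_biUnion_of_mem hi
  have : {y ∈ Y | Q (connectedComponentIn Y y)} =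
      ⋃ i ∈ {i ∈ I | ∃ y ∈ W i, Q (connectedComponentIn Y y)}, W i := by
    ext y
    simp only [mem_ofPred_eq, mem_iUnion, exists_prop]
    constructor
    · rintro ⟨hy, hQ⟩
      have hy' := hy
      rw [hY] at hy'
      simp only [mem_iUnion, exists_prop] at hy'
      obtain ⟨i, hi, hyi⟩ := hy'
      exact ⟨i, ⟨hi, y, hyi, hQ⟩, hyi⟩
    · rintro ⟨i, ⟨hi, z, hz, hQ⟩, hyi⟩
      refine ⟨hsub i hi hyi, ?_⟩
      have h1 : y ∈ connectedComponentIn Y z :=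
        (hWp i hi).subset_connectedComponentIn hz (hsub i hi) hyi
      rw [← connectedComponentIn_eq h1]
      exact hQ
  rw [this]
  exact (hI.subset fun i hi => hi.1).isClosed_biUnion fun i hi => hWc i hi.1

lemma vorCell_closed {n : ℕ} (S : Finset (EuclideanSpace ℝ (Fin n)))
    (x : EuclideanSpace ℝ (Fin n)) : IsClosed (VorCell S x) := by
  have : VorCell S x = ⋂ z ∈ S, {y | dist y x ≤ dist y z} := by ext; simp [VorCell]
  rw [this]
  exact isClosed_biInter fun z _ => isClosed_le (by fun_prop) (by fun_prop)

lemma vorCell_convex {n : ℕ} (S : Finset (EuclideanSpace ℝ (Fin n)))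
    (x : EuclideanSpace ℝ (Fin n)) : Convex ℝ (VorCell S x) := by
  have : VorCell S x = ⋂ z ∈ S, {y | (innerSL ℝ (z - x)) y ≤ (‖z‖ ^ 2 - ‖x‖ ^ 2) / 2} := by
    ext y
    simp only [VorCell, mem_ofPred_eq, mem_iInter]
    refine forall₂_congr fun z _ => ?_
    rw [dist_eq_norm, dist_eq_norm, ← sq_le_sq₀ (norm_nonneg _) (norm_nonneg _),
      norm_sub_sq_real, norm_sub_sq_real, innerSL_apply_apply, inner_sub_left,
      real_inner_comm z y, real_inner_comm x y]
    constructor <;> intro h <;> linarith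
  rw [this]
  exact convex_iInter₂ fun z _ => convex_halfSpace_le (innerSL ℝ (z - x)).isLinear _

/-- Local structure at the vertex. -/
lemma vertex_structure {n : ℕ} 
    (P : Set (EuclideanSpace ℝ (Fin n)))
    (hP : IsPolytope P)
    (h : Set (EuclideanSpace ℝ (Fin n)) → Fin n)
    (hcol : IsProperColoring P h)
    (V : EuclideanSpace ℝ (Fin n)) (hV : IsVertexOf P V)
    (Fν : Fin n → Set (EuclideanSpace ℝ (Fin n)))
    (hFν : ∀ i, IsFacetOf P (Fν i) ∧ V ∈ Fν i ∧ h (Fν i) = i) 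
    (l : Fin n → EuclideanSpace ℝ (Fin n) →L[ℝ] ℝ)
    (hl : ∀ i, Fν i = {x ∈ P | ∀ y ∈ P, l i y ≤ l i x}) :
    (∃ r > 0, ∀ y ∈ Metric.ball V r, (∀ i, l i y < l i V) → y ∈ interior P) ∧
    (∀ w, (∀ i, l i w = 0) → w = 0) := by
  have hPv := polytope_convex hP
  have hPc := polytope_compact hP
  have hcl : closure (interior P) = P := by
    rw [hPv.closure_interior_eq_closure_of_nonempty_interior hP.2, hPc.isClosed.closure_eq]
  have hVm : ∀ i, V ∈ P ∧ ∀ y ∈ P, l i y ≤ l i V := fun i => by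
    have := (hFν i).2.1
    rw [hl i] at this
    exact this
  have hVP : V ∈ P := by
    obtain ⟨m, hm⟩ := hV
    have : V ∈ ({V} : Set (EuclideanSpace ℝ (Fin n))) := rfl
    rw [hm] at this
    exact this.1
  have hlt_int : ∀ y ∈ interior P, ∀ i, l i y < l i V := by
    intro y hy i
    refine lt_of_le_of_ne ((hVm i).2 y (interior_subset hy)) fun heq => ?_
    have hmax : IsLocalMax (l i) y := by
      filter_upwards [mem_interior_iff_mem_nhds.1 hy] with z hz
      rw [heq]
      exact (hVm i).2 z hz
    have hl0 : l i = 0 := hmax.hasFDerivAt_eq_zero (l i).hasFDerivAt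
    have hFP : Fν i = P := by
      rw [hl i, hl0]
      ext; simp
    have hd := (hFν i).1.2
    have htop : affineSpan ℝ P = ⊤ := by
      rw [eq_top_iff, ← isOpen_interior.affineSpan_eq_top hP.2]
      exact affineSpan_mono ℝ interior_subset
    rw [hFP, faceDim, htop, AffineSubspace.direction_top, finrank_top,
      finrank_euclideanSpace_fin] at hd
    have := i.pos
    omega
  have hfar : IsClosed (⋃ F ∈ {F | IsFacetOf P F ∧ V ∉ F}, F) :=
    ((facets_finite hP).subset fun F hF => hF.1).isClosed_biUnion
      fun F hF => (face_closed hPc hF.1.1).isClosed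
  have hVfar : V ∈ (⋃ F ∈ {F | IsFacetOf P F ∧ V ∉ F}, F)ᶜ := by
    simp only [mem_compl_iff, mem_iUnion, not_exists]
    intro F hF hVF
    exact hF.2 hVF
  obtain ⟨r, hr, hball⟩ := Metric.isOpen_iff.1 hfar.isOpen_compl V hVfar
  let U : Set (EuclideanSpace ℝ (Fin n)) := Metric.ball V r ∩ ⋂ i, {y | l i y < l i V}
  have hUconv : Convex ℝ U := (convex_ball V r).inter
    (convex_iInter fun i => convex_halfSpace_lt (l i).isLinear _)
  have hUo : IsOpen U := Metric.isOpen_ball.inter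
    (isOpen_iInter_of_finite fun i => isOpen_lt (l i).continuous continuous_const)
  have hUint : (U ∩ interior P).Nonempty := by
    have : V ∈ closure (interior P) := by rw [hcl]; exact hVP
    obtain ⟨y, hyb, hyi⟩ := mem_closure_iff.1 this _ Metric.isOpen_ball (Metric.mem_ball_self hr)
    exact ⟨y, ⟨hyb, mem_iInter.2 fun i => hlt_int y hyi i⟩, hyi⟩
  have hUP : U ⊆ P := by
    intro y hy
    by_contra hyP
    obtain ⟨z, hzU, hzf⟩ := crossing hPc.isClosed hUconv.isPreconnected hUint ⟨y, hy, hyP⟩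
    obtain ⟨F, hF, hzF⟩ := mem_facet hP (hPc.isClosed.frontier_subset hzf) hzf.2
    by_cases hVF : V ∈ F
    · have hFeq : F = Fν (h F) := by
        by_contra hne
        exact hcol F (Fν (h F)) hF (hFν _).1 hne ⟨V, hVF, (hFν _).2.1⟩ (hFν _).2.2.symm
      rw [hFeq, hl] at hzF
      have h1 := hzF.2 V hVP
      have h2 := mem_iInter.1 hzU.2 (h F)
      exact absurd h2 (not_lt.2 h1)
    · apply hball hzU.1
      simp only [mem_iUnion]
      exact ⟨F, ⟨hF, hVF⟩, hzF⟩
  have hUI : U ⊆ interior P := interior_maximal hUP hUo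
  refine ⟨⟨r, hr, fun y hy hyl => hUI ⟨hy, mem_iInter.2 hyl⟩⟩, ?_⟩
  intro w hw
  by_contra hw0
  have hwn : 0 < ‖w‖ := norm_pos_iff.2 hw0
  have hmem : ∀ τ : ℝ, |τ| * ‖w‖ ≤ r / 2 → V + τ • w ∈ P := by
    intro τ hτ
    have hVc : V ∈ closure (Metric.ball V (r/2) ∩ interior P) := by
      have : V ∈ closure (interior P) := by rw [hcl]; exact hVP
      exact Metric.isOpen_ball.inter_closure ⟨Metric.mem_ball_self (by positivity), this⟩
    have hmaps : MapsTo (fun y => y + τ • w) (Metric.ball V (r/2) ∩ interior P) P := by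
      rintro y ⟨hyb, hyi⟩
      apply hUP
      refine ⟨?_, mem_iInter.2 fun i => ?_⟩
      · rw [Metric.mem_ball, dist_eq_norm] at hyb ⊢
        calc ‖y + τ • w - V‖ = ‖(y - V) + τ • w‖ := by congr 1; abel
          _ ≤ ‖y - V‖ + ‖τ • w‖ := norm_add_le _ _
          _ = ‖y - V‖ + |τ| * ‖w‖ := by rw [norm_smul, Real.norm_eq_abs]
          _ < r := by linarith
      · have := hlt_int y hyi i
        simpa [hw i] using this
    have := hmaps.closure (by fun_prop) hVc
    rwa [hPc.isClosed.closure_eq] at this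
  have ht : |r / 2 / ‖w‖| * ‖w‖ ≤ r / 2 := by
    rw [abs_of_pos (by positivity)]
    field_simp
    exact le_refl _
  have ht' : |-(r / 2 / ‖w‖)| * ‖w‖ ≤ r / 2 := by rw [abs_neg]; exact ht
  have hp1 := hmem _ ht
  have hp2 := hmem _ ht'
  set t := r / 2 / ‖w‖ with htdef
  have htpos : 0 < t := by positivity
  obtain ⟨m, hm⟩ := hV
  have hVmax : V ∈ {x ∈ P | ∀ y ∈ P, m y ≤ m x} := by rw [← hm]; rfl
  have e1 := hVmax.2 _ hp1
  have e2 := hVmax.2 _ hp2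
  simp only [map_add, map_smul, smul_eq_mul] at e1 e2
  have e3 : t * m w = 0 := by linarith
  have : V + t • w ∈ ({V} : Set (EuclideanSpace ℝ (Fin n))) := by
    rw [hm]
    refine ⟨hp1, fun y hy => ?_⟩
    simp only [map_add, map_smul, smul_eq_mul, e3, add_zero]
    exact hVmax.2 y hy
  have h5 : t • w = 0 := by simpa using this
  exact hw0 ((smul_eq_zero.1 h5).resolve_left htpos.ne')

/-- **The colorful Voronoi–Hex game is always decided.** Let `S ⊆ ℝ^n` be a finite
nonempty set with Voronoi cells `VorCell S x`, let `P ⊆ ℝ^n` be a full-dimensional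
simple polytope with a proper coloring `h` of its facets by `n` colors, let `V` be a
vertex of `P` and `Fν i` the (unique) facet of color `i` containing `V`. For any
assignment `c` of colors to the points of `S`, let `X i` be the part of `P` covered by
Voronoi cells of points of color `i`. Then some color `i` has a connected component of
`X i` joining `Fν i` to another facet of color `i`. -/
theorem colorful_voronoi_hex {n : ℕ} (S : Finset (EuclideanSpace ℝ (Fin n)))
    (hS : S.Nonempty)
    (P : Set (EuclideanSpace ℝ (Fin n)))
    (hP : IsSimplePolytope P)
    (h : Set (EuclideanSpace ℝ (Fin n)) → Fin n)
    (hcol : IsProperColoring P h)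
    (V : EuclideanSpace ℝ (Fin n)) (hV : IsVertexOf P V)
    (Fν : Fin n → Set (EuclideanSpace ℝ (Fin n)))
    (hFν : ∀ i, IsFacetOf P (Fν i) ∧ V ∈ Fν i ∧ h (Fν i) = i)
    (c : EuclideanSpace ℝ (Fin n) → Fin n)
    (X : Fin n → Set (EuclideanSpace ℝ (Fin n)))
    (hX : ∀ i, X i = {y ∈ P | ∃ x ∈ S, c x = i ∧ y ∈ VorCell S x}) :
    ∃ (i : Fin n) (y : EuclideanSpace ℝ (Fin n)), y ∈ X i ∧
      (connectedComponentIn (X i) y ∩ Fν i).Nonempty ∧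
      ∃ F, IsFacetOf P F ∧ F ≠ Fν i ∧ h F = i ∧
        (connectedComponentIn (X i) y ∩ F).Nonempty := by
  classical
  by_contra hcon
  have hPp := hP.1
  have hPv := polytope_convex hPp
  have hPc := polytope_compact hPp
  choose l hl using fun i => (hFν i).1.1
  obtain ⟨⟨r, hr, hrint⟩, hinj⟩ := vertex_structure P hPp h hcol V hV Fν hFν l hl
  have hVm : ∀ i, V ∈ P ∧ ∀ y ∈ P, l i y ≤ l i V := fun i => by
    have := (hFν i).2.1
    rw [hl i] at this
    exact this
  -- the other facets of color `i`
  let O : Fin n → Set (EuclideanSpace ℝ (Fin n)) := fun i =>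
    ⋃ F ∈ {F | IsFacetOf P F ∧ F ≠ Fν i ∧ h F = i}, F
  have hOc : ∀ i, IsCompact (O i) := fun i =>
    ((facets_finite hPp).subset fun F hF => hF.1).isCompact_biUnion
      fun F hF => face_closed hPc hF.1.1
  have memO : ∀ i y, y ∈ O i ↔ ∃ F, (IsFacetOf P F ∧ F ≠ Fν i ∧ h F = i) ∧ y ∈ F := by
    intro i y
    simp only [O, mem_iUnion]
    exact ⟨fun ⟨F, hF, hy⟩ => ⟨F, hF, hy⟩, fun ⟨F, hF, hy⟩ => ⟨F, hF, hy⟩⟩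
  have hOP : ∀ i, O i ⊆ P := by
    intro i y hy
    obtain ⟨F, ⟨hF, -, -⟩, hyF⟩ := (memO i y).1 hy
    obtain ⟨m, hm⟩ := hF.1
    rw [hm] at hyF
    exact hyF.1
  have hOF : ∀ i, ∀ y ∈ O i, y ∉ Fν i := by
    intro i y hy hyν
    obtain ⟨F, ⟨hF, hne, hc⟩, hyF⟩ := (memO i y).1 hy
    exact hcol F (Fν i) hF (hFν i).1 hne ⟨y, hyF, hyν⟩ (hc.trans (hFν i).2.2.symm)
  have hOlt : ∀ i, ∀ y ∈ O i, l i y < l i V := by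
    intro i y hy
    refine lt_of_le_of_ne ((hVm i).2 y (hOP i hy)) fun heq => hOF i y hy ?_
    rw [hl i]
    exact ⟨hOP i hy, fun z hz => heq ▸ (hVm i).2 z hz⟩
  have hδ : ∀ i, ∃ δ > 0, ∀ y ∈ O i, δ ≤ l i V - l i y := by
    intro i
    rcases (O i).eq_empty_or_nonempty with he | hne
    · exact ⟨1, one_pos, fun y hy => by rw [he] at hy; exact hy.elim⟩
    · obtain ⟨y₀, hy₀, hmin⟩ := (hOc i).exists_isMinOn hne
        (show ContinuousOn (fun y => l i V - l i y) (O i) by fun_prop)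
      exact ⟨l i V - l i y₀, sub_pos.2 (hOlt i y₀ hy₀), fun y hy => hmin hy⟩
  choose δ hδ0 hδle using hδ
  -- the coordinate system at `V`
  let L₀ : EuclideanSpace ℝ (Fin n) →ₗ[ℝ] EuclideanSpace ℝ (Fin n) :=
    { toFun := fun y => WithLp.toLp 2 fun i => l i y
      map_add' := fun a b => by ext i; simp
      map_smul' := fun a b => by ext i; simp }
  have hL₀ : Function.Injective L₀ := by
    rw [injective_iff_map_eq_zero]
    intro w hw
    refine hinj w fun i => ?_
    have := congrArg (fun v : EuclideanSpace ℝ (Fin n) => v i) hw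
    simpa [L₀] using this
  let L : EuclideanSpace ℝ (Fin n) ≃L[ℝ] EuclideanSpace ℝ (Fin n) :=
    (LinearEquiv.ofInjectiveEndo L₀ hL₀).toContinuousLinearEquiv
  have hLapp : ∀ y i, L y i = l i y := fun y i => rfl
  let d := L.symm (WithLp.toLp 2 fun _ => (1:ℝ))
  have hd : ∀ i, l i d = 1 := by
    intro i
    rw [← hLapp]
    simp [d]
  obtain ⟨ε, hε0, hεr, hεδ⟩ : ∃ ε : ℝ, 0 < ε ∧ ε * ‖d‖ < r ∧ ∀ i, ε < δ i := by
    have e1 : ∀ᶠ ε in nhdsWithin (0:ℝ) (Ioi 0), 0 < ε := self_mem_nhdsWithin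
    have e2 : ∀ᶠ ε in nhdsWithin (0:ℝ) (Ioi 0), ε * ‖d‖ < r := by
      refine nhdsWithin_le_nhds ?_
      have : Filter.Tendsto (fun ε : ℝ => ε * ‖d‖) (nhds 0) (nhds (0 * ‖d‖)) :=
        (continuous_id.mul continuous_const).tendsto 0
      exact this.eventually_lt_const (by simpa using hr)
    have e3 : ∀ᶠ ε in nhdsWithin (0:ℝ) (Ioi 0), ∀ i, ε < δ i :=
      Filter.eventually_all.2 fun i => nhdsWithin_le_nhds (eventually_lt_nhds (hδ0 i))
    obtain ⟨ε, h1, h2, h3⟩ := (e1.and (e2.and e3)).exists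
    exact ⟨ε, h1, h2, h3⟩
  let g : EuclideanSpace ℝ (Fin n) ≃ₜ EuclideanSpace ℝ (Fin n) :=
    L.toHomeomorph.trans (Homeomorph.addRight (- L (V - ε • d)))
  have hgapp : ∀ y i, g y i = ε - (l i V - l i y) := by
    intro y i
    have : g y = L y + - L (V - ε • d) := rfl
    rw [this, PiLp.add_apply, PiLp.neg_apply, hLapp, hLapp]
    simp [hd]
    ring
  have hgs : g.symm 0 = V - ε • d := by
    rw [Homeomorph.symm_apply_eq]
    have : g (V - ε • d) = L (V - ε • d) + - L (V - ε • d) := rfl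
    rw [this, add_neg_cancel]
  have hg0 : g.symm 0 ∈ interior P := by
    rw [hgs]
    refine hrint _ ?_ fun i => ?_
    · rw [Metric.mem_ball, dist_eq_norm, sub_sub_cancel_left, norm_neg, norm_smul,
        Real.norm_of_nonneg hε0.le]
      exact hεr
    · simp [hd, hε0]
  -- the two parts of `X i`
  let Q : Fin n → Set (EuclideanSpace ℝ (Fin n)) → Prop := fun i C => (C ∩ Fν i).Nonempty
  have hXu : ∀ i, X i = ⋃ x ∈ {x | x ∈ S ∧ c x = i}, (P ∩ VorCell S x) := by
    intro i
    rw [hX i]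
    ext y
    simp only [mem_iUnion]
    constructor
    · rintro ⟨hy, x, hxS, hxc, hyx⟩
      exact ⟨x, ⟨hxS, hxc⟩, hy, hyx⟩
    · rintro ⟨x, ⟨hxS, hxc⟩, hy, hyx⟩
      exact ⟨hy, x, hxS, hxc, hyx⟩
  have hcc : ∀ i (Q' : Set (EuclideanSpace ℝ (Fin n)) → Prop),
      IsClosed {y ∈ X i | Q' (connectedComponentIn (X i) y)} := fun i Q' =>
    closed_components {x | x ∈ S ∧ c x = i} (S.finite_toSet.subset fun x hx => hx.1)
      (fun x => P ∩ VorCell S x) (fun x _ => hPc.isClosed.inter (vorCell_closed S x))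
      (fun x _ => (hPv.inter (vorCell_convex S x)).isPreconnected) (X i) (hXu i) Q'
  let A : Fin n → Set (EuclideanSpace ℝ (Fin n)) := fun i =>
    {y ∈ X i | Q i (connectedComponentIn (X i) y)}
  let B : Fin n → Set (EuclideanSpace ℝ (Fin n)) := fun i =>
    {y ∈ X i | ¬ Q i (connectedComponentIn (X i) y)}
  have hdisj : ∀ i, Disjoint (B i ∪ O i) (A i ∪ Fν i) := by
    intro i
    rw [Set.disjoint_left]
    rintro y (hyB | hyO) (hyA | hyF)
    · exact hyB.2 hyA.2
    · exact hyB.2 ⟨y, mem_connectedComponentIn hyB.1, hyF⟩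
    · obtain ⟨F, ⟨hF, hne, hFc⟩, hyF⟩ := (memO i y).1 hyO
      exact hcon ⟨i, y, hyA.1, hyA.2, F, hF, hne, hFc, y, mem_connectedComponentIn hyA.1, hyF⟩
    · exact hOF i y hyO hyF
  choose φ hφ0 hφ1 _ using fun i => exists_continuous_zero_one_of_isClosed
    ((hcc i fun C => ¬ Q i C).union (hOc i).isClosed)
    ((hcc i (Q i)).union (face_closed hPc (hFν i).1.1).isClosed) (hdisj i)
  let f : EuclideanSpace ℝ (Fin n) → EuclideanSpace ℝ (Fin n) := fun y =>
    WithLp.toLp 2 fun i => 2 * φ i y - 1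
  have hfi : ∀ y i, f y i = 2 * φ i y - 1 := fun y i => rfl
  refine homotopy_contra hPc f ?_ ?_ g hg0 ?_
  · have : ∀ i, Continuous (φ i) := fun i => (φ i).continuous
    fun_prop
  · intro y hy h0
    obtain ⟨x, hxS, hxmin⟩ := S.exists_min_image (fun z => dist y z) hS
    have hyX : y ∈ X (c x) := by
      rw [hX]
      exact ⟨hy, x, hxS, rfl, hxmin⟩
    have h1 : f y (c x) = 0 := by rw [h0]; rfl
    rw [hfi] at h1
    by_cases hQ : Q (c x) (connectedComponentIn (X (c x)) y)
    · have : φ (c x) y = 1 := hφ1 (c x) (Or.inl ⟨hyX, hQ⟩)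
      rw [this] at h1
      norm_num at h1
    · have : φ (c x) y = 0 := hφ0 (c x) (Or.inl ⟨hyX, hQ⟩)
      rw [this] at h1
      norm_num at h1
  · intro y hy hyi t ht h0
    obtain ⟨F, hF, hyF⟩ := mem_facet hPp hy hyi
    have h1 : ((1 - t) • f y + t • g y) (h F) = 0 := by rw [h0]; rfl
    rw [PiLp.add_apply, PiLp.smul_apply, PiLp.smul_apply, hfi, hgapp, smul_eq_mul,
      smul_eq_mul] at h1
    obtain ⟨ht0, ht1⟩ := ht
    by_cases hFe : F = Fν (h F)
    · rw [hFe] at hyF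
      have h2 : φ (h F) y = 1 := hφ1 (h F) (Or.inr hyF)
      have h3 : l (h F) y = l (h F) V := by
        rw [hl] at hyF
        exact le_antisymm ((hVm _).2 y hy) (hyF.2 V (hVm (h F)).1)
      rw [h2, h3] at h1
      rcases ht0.eq_or_lt with rfl | ht0
      · norm_num at h1
      · nlinarith [mul_pos ht0 hε0]
    · have hyO : y ∈ O (h F) := (memO _ y).2 ⟨F, ⟨hF, hFe, rfl⟩, hyF⟩
      have h2 : φ (h F) y = 0 := hφ0 (h F) (Or.inr hyO)
      have h3 := hδle _ y hyO
      have h4 := hεδ (h F)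
      rw [h2] at h1
      rcases ht0.eq_or_lt with rfl | ht0
      · norm_num at h1
      · have : 0 < t * (l (h F) V - l (h F) y - ε) := mul_pos ht0 (by linarith)
        nlinarith


end
end
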